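/- The norm map N : Cl(R_f) → Cl⁺(R⁺_f) is surjective. -/

import Mathlib

noncomputable section
open Complex Pointwise

/-- `√−2 = i·√2` -/
def sm2 : ℂ := Complex.I * Real.sqrt 2
/-- `√−D = i·√D` -/
def smD (D : ℕ) : ℂ := Complex.I * Real.sqrt D
/-- `√(2D)` -/
def s2D (D : ℕ) : ℂ := (Real.sqrt (2 * D) : ℝ)
/-- `w = (√(2D) + √−2)/2` -/
def w (D : ℕ) : ℂ := (s2D D + sm2) / 2
/-- `𝒪 = ℤ[√−2]` -/
def OO : Subring ℂ := Subring.closure {sm2}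
/-- `R_f = 𝒪 + f·w·𝒪 = ℤ[√−2, f·w]`, an order in `K`. -/
def Rf (D f : ℕ) : Subring ℂ := Subring.closure {sm2, (f : ℂ) * w D}
/-- `R⁺_f = ℤ[f·√(2D)]`, an order in `K⁺`. -/
def Rpf (D f : ℕ) : Subring ℂ := Subring.closure {(f : ℂ) * s2D D}
/-- `S_f = ℤ[f·√−D]`, an order in `L`. -/
def Sf (D f : ℕ) : Subring ℂ := Subring.closure {(f : ℂ) * smD D}
/-- `K = ℚ(√−2, √−D)` -/
def Kf (D : ℕ) : IntermediateField ℚ ℂ := IntermediateField.adjoin ℚ {sm2, smD D}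
/-- `K⁺ = ℚ(√(2D))`, the maximal real subfield of `K`. -/
def Kp (D : ℕ) : IntermediateField ℚ ℂ := IntermediateField.adjoin ℚ {s2D D}
/-- `L = ℚ(√−D)` -/
def Lf (D : ℕ) : IntermediateField ℚ ℂ := IntermediateField.adjoin ℚ {smD D}

/-- The complex conjugate `𝔄̄` of a fractional ideal `𝔄` of a subring of `ℂ`. -/
def conjSubmodule (R : Subring ℂ) (A : Submodule R ℂ) : Submodule R ℂ :=
  Submodule.span R ((starRingEnd ℂ) '' (A : Set ℂ))

/-- A lattice `{X ≡ kY + lZ mod AB}` contains a nonzero vector in the box with sides `√(AB)`,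
`√B`, `√A`, by the pigeonhole principle. -/
theorem exists_small_three (A B : ℕ) (hA : 0 < A) (hB : 0 < B) (k l : ℤ) :
    ∃ X Y Z : ℤ, ¬ (X = 0 ∧ Y = 0 ∧ Z = 0) ∧ ((A * B : ℕ) : ℤ) ∣ X - k * Y - l * Z ∧
      X ^ 2 ≤ A * B ∧ Y ^ 2 ≤ B ∧ Z ^ 2 ≤ A := by
  have hAB : 0 < A * B := Nat.mul_pos hA hB
  have : NeZero (A * B) := ⟨hAB.ne'⟩
  let s := Finset.range (Nat.sqrt (A * B) + 1) ×ˢ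
    (Finset.range (Nat.sqrt B + 1) ×ˢ Finset.range (Nat.sqrt A + 1))
  let φ : ℕ × ℕ × ℕ → ZMod (A * B) := fun v => (v.1 : ZMod (A * B)) - k * v.2.1 - l * v.2.2
  have hcard : (Finset.univ : Finset (ZMod (A * B))).card < s.card := by
    simp only [s, Finset.card_univ, ZMod.card, Finset.card_product, Finset.card_range]
    have h1 := Nat.lt_succ_sqrt' (A * B)
    have h2 := Nat.lt_succ_sqrt' B
    have h3 := Nat.lt_succ_sqrt' A
    simp only [Nat.succ_eq_add_one] at h1 h2 h3
    refine lt_of_pow_lt_pow_left₀ 2 (Nat.zero_le _) ?_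
    calc (A * B) ^ 2 = (A * B) * (B * A) := by ring
      _ < (Nat.sqrt (A * B) + 1) ^ 2 * ((Nat.sqrt B + 1) ^ 2 * (Nat.sqrt A + 1) ^ 2) := by gcongr
      _ = _ := by ring
  obtain ⟨v, hv, v', hv', hne, heq⟩ :=
    Finset.exists_ne_map_eq_of_card_lt_of_maps_to (f := φ) hcard (fun _ _ => Finset.mem_univ _)
  obtain ⟨x, y, z⟩ := v
  obtain ⟨x', y', z'⟩ := v'
  simp only [s, Finset.mem_product, Finset.mem_range,
    Nat.lt_add_one_iff] at hv hv'
  have key : ∀ a b N : ℕ, a < Nat.sqrt N + 1 → b < Nat.sqrt N + 1 → ((a : ℤ) - b) ^ 2 ≤ N := by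
    intro a b N ha hb
    have h0 := Nat.sqrt_le' N
    have : (a - b : ℤ) ^ 2 ≤ (Nat.sqrt N : ℤ) ^ 2 := by
      apply sq_le_sq' <;> omega
    exact this.trans (by exact_mod_cast h0)
  refine ⟨x - x', y - y', z - z', ?_, ?_, ?_, key _ _ _ (by omega) (by omega),
    key _ _ _ (by omega) (by omega)⟩
  · rintro ⟨h1, h2, h3⟩
    apply hne
    simp only [Prod.mk.injEq]
    omega
  · rw [← ZMod.intCast_zmod_eq_zero_iff_dvd]
    simp only [φ] at heq
    push_cast
    linear_combination heq
  · exact_mod_cast key x x' (A * B) (by omega) (by omega)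

theorem exists_small_two (p : ℕ) (hp : 0 < p) (k : ℤ) :
    ∃ X Y : ℤ, ¬ (X = 0 ∧ Y = 0) ∧ (p : ℤ) ∣ X - k * Y ∧ X ^ 2 ≤ p ∧ Y ^ 2 ≤ p := by
  have : NeZero p := ⟨hp.ne'⟩
  let s := Finset.range (Nat.sqrt p + 1) ×ˢ Finset.range (Nat.sqrt p + 1)
  let φ : ℕ × ℕ → ZMod p := fun v => (v.1 : ZMod p) - k * v.2
  have hcard : (Finset.univ : Finset (ZMod p)).card < s.card := by
    simp only [s, Finset.card_univ, ZMod.card, Finset.card_product, Finset.card_range]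
    exact Nat.lt_succ_sqrt p
  obtain ⟨v, hv, v', hv', hne, heq⟩ :=
    Finset.exists_ne_map_eq_of_card_lt_of_maps_to (f := φ) hcard (fun _ _ => Finset.mem_univ _)
  obtain ⟨x, y⟩ := v
  obtain ⟨x', y'⟩ := v'
  simp only [s, Finset.mem_product, Finset.mem_range] at hv hv'
  have key : ∀ a b : ℕ, a < Nat.sqrt p + 1 → b < Nat.sqrt p + 1 → ((a : ℤ) - b) ^ 2 ≤ p := by
    intro a b ha hb
    have h0 := Nat.sqrt_le' p
    have : (a - b : ℤ) ^ 2 ≤ (Nat.sqrt p : ℤ) ^ 2 := by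
      apply sq_le_sq' <;> omega
    exact this.trans (by exact_mod_cast h0)
  refine ⟨x - x', y - y', ?_, ?_, key _ _ (by omega) (by omega), key _ _ (by omega) (by omega)⟩
  · rintro ⟨h1, h2⟩
    apply hne
    simp only [Prod.mk.injEq]
    omega
  · rw [← ZMod.intCast_zmod_eq_zero_iff_dvd]
    simp only [φ] at heq
    push_cast
    linear_combination heq

theorem prime_eq_sq_add_two_mul_sq (p : ℕ) (hp : p.Prime) (h : p % 8 = 1 ∨ p % 8 = 3) :
    ∃ u v : ℤ, (p : ℤ) = u ^ 2 + 2 * v ^ 2 := by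
  have := Fact.mk hp
  have hp2 : p ≠ 2 := by rintro rfl; omega
  obtain ⟨s, hs⟩ := (ZMod.exists_sq_eq_neg_two_iff hp2).2 h
  obtain ⟨X, Y, h0, hd, hX, hY⟩ := exists_small_two p hp.pos (s.val : ℤ)
  have hsq : ∀ a : ℤ, a ^ 2 ≠ p := by
    intro a ha
    exact (Nat.prime_iff_prime_int.1 hp).not_isSquare ⟨a, by rw [← ha]; ring⟩
  have hdiv : (p : ℤ) ∣ X ^ 2 + 2 * Y ^ 2 := by
    rw [← ZMod.intCast_zmod_eq_zero_iff_dvd] at hd ⊢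
    push_cast at hd ⊢
    rw [ZMod.natCast_zmod_val] at hd
    linear_combination (X + s * Y) * hd - (Y : ZMod p) ^ 2 * hs
  obtain ⟨k, hk⟩ := hdiv
  have hX' := lt_of_le_of_ne hX (hsq X)
  have hY' := lt_of_le_of_ne hY (hsq Y)
  have hpos : 0 < X ^ 2 + 2 * Y ^ 2 := by
    rcases not_and_or.1 h0 with h | h <;> positivity
  have hp0 : (0 : ℤ) < p := by exact_mod_cast hp.pos
  have hk1 : 0 < k := by
    by_contra hcon
    nlinarith
  have hk3 : k < 3 := by
    by_contra hcon
    nlinarith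
  interval_cases k
  · exact ⟨X, Y, by linarith⟩
  · have : Even (X ^ 2) := ⟨p - Y ^ 2, by linarith⟩
    obtain ⟨x, rfl⟩ := (Int.even_pow' two_ne_zero).1 this
    exact ⟨Y, x, by nlinarith⟩

open scoped NumberTheorySymbols

theorem jacobiSym_two_mul_eq_of_modEq {D n p : ℕ} (hD4 : D % 4 = 1) (hn : Odd n) (hp : Odd p)
    (h8 : ((p : ℤ) - n) % 8 = 0 ∨ ((p : ℤ) + n) % 8 = 0) (hD : (D : ℤ) ∣ p - n) :
    J(2 * D | p) = J(2 * D | n) := by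
  rw [jacobiSym.mul_left, jacobiSym.mul_left, jacobiSym.at_two hn, jacobiSym.at_two hp,
    jacobiSym.quadratic_reciprocity_one_mod_four hD4 hn,
    jacobiSym.quadratic_reciprocity_one_mod_four hD4 hp]
  congr 1
  · rw [ZMod.χ₈_nat_eq_if_mod_eight, ZMod.χ₈_nat_eq_if_mod_eight]
    have := Nat.odd_iff.1 hn
    have := Nat.odd_iff.1 hp
    split_ifs <;> omega
  · exact jacobiSym.mod_left' (Int.emod_eq_emod_iff_emod_sub_eq_zero.2 (Int.emod_eq_zero_of_dvd hD))

theorem exists_prime_of_genus {D f n : ℕ} (hD0 : 0 < D) (hD4 : D % 4 = 1) (hf : Odd f)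
    (hn : Odd n) (hc : IsCoprime (n : ℤ) (D * f)) (hJ : J(2 * D | n) = 1) :
    ∃ p : ℕ, p.Prime ∧ (p % 8 = 1 ∨ p % 8 = 3) ∧ n + 2 * D * f < p ∧
      (D * f : ℤ) ∣ p - n ∧ J(2 * D | p) = 1 := by
  have hDf : Odd (D * f) := (Nat.odd_iff.2 (by omega)).mul hf
  have hDf0 : 0 < D * f := Nat.mul_pos hD0 hf.pos
  have hDf8 : (8 : ℤ) ∣ ((D * f : ℕ) : ℤ) ^ 2 - 1 :=
    Int.eight_dvd_sq_sub_one_of_odd (by exact_mod_cast hDf)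
  have : NeZero (8 * (D * f)) := ⟨by positivity⟩
  obtain ⟨a, ha8, haD⟩ : ∃ a : ℤ, ((a % 8 = 1 ∨ a % 8 = 3) ∧
      ((a - n) % 8 = 0 ∨ (a + n) % 8 = 0)) ∧ (D * f : ℤ) ∣ a - n := by
    have hn' := Nat.odd_iff.1 hn
    by_cases h : n % 8 = 1 ∨ n % 8 = 3
    · exact ⟨n, ⟨by omega, by simp⟩, by simp⟩
    · refine ⟨n * (1 - 2 * ((D * f : ℕ) : ℤ) ^ 2), ?_, ⟨-2 * n * (D * f), by push_cast; ring⟩⟩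
      have : ((n : ℤ) * (1 - 2 * ((D * f : ℕ) : ℤ) ^ 2)) % 8 = (-n) % 8 := by
        obtain ⟨k, hk⟩ := hDf8
        rw [show ((D * f : ℕ) : ℤ) ^ 2 = 8 * k + 1 by linarith,
          show (n : ℤ) * (1 - 2 * (8 * k + 1)) = -n + 8 * (-2 * n * k) by ring]
        omega
      omega
  have hunit : IsUnit ((a : ℤ) : ZMod (8 * (D * f))) := by
    rw [ZMod.coe_int_isUnit_iff_isCoprime]
    push_cast
    refine IsCoprime.mul_left ?_ ?_
    · have : IsCoprime ((2 : ℤ) ^ 3) a :=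
        IsCoprime.pow_left (Int.isCoprime_two_left.2 (Int.odd_iff.2 (by omega)))
      simpa using this
    · obtain ⟨k, hk⟩ := haD
      rw [show a = n + (D * f) * k by linarith]
      exact hc.symm.add_mul_left_right k
  obtain ⟨p, hgt, hp, hpa⟩ := Nat.forall_exists_prime_gt_and_eq_mod hunit (n + 2 * D * f)
  have hd : ((8 * (D * f) : ℕ) : ℤ) ∣ p - a := by
    rw [← ZMod.intCast_zmod_eq_zero_iff_dvd]
    push_cast
    rw [hpa, sub_self]
  have hd8 : (8 : ℤ) ∣ p - a := (Dvd.intro (D * f : ℤ) (by push_cast; ring)).trans hd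
  have hdD : (D * f : ℤ) ∣ p - n := by
    have : (D * f : ℤ) ∣ p - a := (Dvd.intro_left 8 (by push_cast; ring)).trans hd
    simpa using this.add haD
  have hp8 : p % 8 = 1 ∨ p % 8 = 3 := by omega
  refine ⟨p, hp, hp8, hgt, hdD, ?_⟩
  rw [jacobiSym_two_mul_eq_of_modEq hD4 hn (Nat.odd_iff.2 (by omega)) (by omega)
    ((Dvd.intro _ rfl).trans hdD), hJ]

theorem eq_zero_of_sq_eq_mul_sq {A X Y : ℤ} (hA : ¬ IsSquare A) (h : X ^ 2 = A * Y ^ 2) :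
    Y = 0 := by
  by_contra hY
  obtain ⟨k, rfl⟩ : Y ∣ X := (Int.pow_dvd_pow_iff two_ne_zero).1 ⟨A, by rw [h]; ring⟩
  refine hA ⟨k, mul_left_cancel₀ (pow_ne_zero 2 hY) ?_⟩
  linear_combination -h

/-- Legendre's theorem for `X² - AY² = BZ²`, with control of the solution modulo `B`. -/
theorem exists_conic_solution {A B : ℕ} (hA0 : 0 < A) (hB0 : 0 < B)
    (hAB : IsCoprime (A : ℤ) B) (hA : ¬ IsSquare (A : ℤ)) (hsq : ¬ IsSquare ((A : ℤ) * B))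
    {r s : ℤ} (hr : (B : ℤ) ∣ r ^ 2 - A) (hs : (A : ℤ) ∣ s ^ 2 - B) :
    ∃ X Y Z : ℤ, Z ≠ 0 ∧ X ^ 2 - A * Y ^ 2 = B * Z ^ 2 ∧ (B : ℤ) ∣ X - r * Y := by
  obtain ⟨i, j, hij⟩ := hAB
  obtain ⟨X, Y, Z, h0, hd, hX, hY, hZ⟩ :=
    exists_small_three A B hA0 hB0 (i * A * r) (j * B * s)
  have hA0' : (0 : ℤ) < A := by exact_mod_cast hA0
  have hB0' : (0 : ℤ) < B := by exact_mod_cast hB0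
  have hdB : (B : ℤ) ∣ X - r * Y := by
    obtain ⟨k, hk⟩ := hd
    push_cast at hk
    exact ⟨A * k + j * s * Z - r * Y * j, by linear_combination hk + r * Y * hij⟩
  have hdA : (A : ℤ) ∣ X - s * Z := by
    obtain ⟨k, hk⟩ := hd
    push_cast at hk
    exact ⟨B * k + i * r * Y - s * Z * i, by linear_combination hk + s * Z * hij⟩
  have hF : (A * B : ℤ) ∣ X ^ 2 - A * Y ^ 2 - B * Z ^ 2 := by
    refine IsCoprime.mul_dvd ⟨i, j, hij⟩ ?_ ?_
    · obtain ⟨k, hk⟩ := hdA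
      obtain ⟨l, hl⟩ := hs
      exact ⟨k * (X + s * Z) - Y ^ 2 + l * Z ^ 2,
        by linear_combination (X + s * Z) * hk + Z ^ 2 * hl⟩
    · obtain ⟨k, hk⟩ := hdB
      obtain ⟨l, hl⟩ := hr
      exact ⟨k * (X + r * Y) - Z ^ 2 + l * Y ^ 2,
        by linear_combination (X + r * Y) * hk + Y ^ 2 * hl⟩
  obtain ⟨t, ht⟩ := hF
  have hABpos : (0 : ℤ) < A * B := by positivity
  have hX' : X ^ 2 < A * B := lt_of_le_of_ne hX fun h => hsq ⟨X, by rw [← h]; ring⟩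
  have hZ' : Z ^ 2 < A := lt_of_le_of_ne hZ fun h => hA ⟨Z, by rw [← h]; ring⟩
  have ht1 : t < 1 := by
    by_contra hcon
    have : (A * B : ℤ) * 1 ≤ A * B * t := by gcongr; omega
    nlinarith [sq_nonneg Y, sq_nonneg Z]
  have ht2 : -2 < t := by
    by_contra hcon
    have : (A * B : ℤ) * t ≤ A * B * (-2) := by gcongr; omega
    nlinarith [sq_nonneg X]
  obtain rfl | rfl : t = 0 ∨ t = -1 := by omega
  · refine ⟨X, Y, Z, ?_, by linarith, hdB⟩
    rintro rfl
    have hY0 : Y = 0 := eq_zero_of_sq_eq_mul_sq hA (X := X) (by linarith)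
    subst hY0
    have : X = 0 := by
      have : X ^ 2 = 0 := by linarith
      simpa using this
    exact h0 ⟨this, rfl, rfl⟩
  · refine ⟨X * Z + A * Y, X + Y * Z, Z ^ 2 - A, by linarith, ?_, ?_⟩
    · linear_combination (Z ^ 2 - A) * ht
    · obtain ⟨k, hk⟩ := hdB
      obtain ⟨l, hl⟩ := hr
      exact ⟨k * (Z - r) - Y * l, by linear_combination (Z - r) * hk - Y * hl⟩

theorem dvd_of_sq_dvd_squarefree_mul_sq {A q Y : ℤ} (hA : Squarefree A) (hq : Prime q)
    (h : q ^ 2 ∣ A * Y ^ 2) : q ∣ Y := by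
  by_contra hY
  have : q ^ 2 ∣ A := IsCoprime.dvd_of_dvd_mul_right
    (IsCoprime.pow ((Irreducible.coprime_iff_not_dvd hq.irreducible).2 hY)) h
  exact hq.not_isUnit (hA q (by rwa [← pow_two]))

/-- A solution of the conic can be chosen so that no prime factor of `f` divides both `X`, `Z`. -/
theorem exists_conic_solution_primitive_at {A B f n r : ℤ} (hA : Squarefree A)
    (hfn : IsCoprime f n)
    (h : ∃ X Y Z : ℤ, Z ≠ 0 ∧ X ^ 2 - A * Y ^ 2 = B * Z ^ 2 ∧ n ∣ X - r * Y) :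
    ∃ X Y Z : ℤ, Z ≠ 0 ∧ X ^ 2 - A * Y ^ 2 = B * Z ^ 2 ∧ n ∣ X - r * Y ∧
      ∀ q, Prime q → q ∣ f → ¬ (q ∣ X ∧ q ∣ Z) := by
  obtain ⟨X, Y, Z, hZ, heq, hd⟩ := h
  induction hk : Z.natAbs using Nat.strong_induction_on generalizing X Y Z with
  | _ k ih =>
    by_cases hall : ∀ q, Prime q → q ∣ f → ¬ (q ∣ X ∧ q ∣ Z)
    · exact ⟨X, Y, Z, hZ, heq, hd, hall⟩
    push Not at hall
    obtain ⟨q, hq, hqf, ⟨x, rfl⟩, ⟨z, rfl⟩⟩ := hall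
    obtain ⟨y, rfl⟩ : q ∣ Y := dvd_of_sq_dvd_squarefree_mul_sq hA hq
      ⟨x ^ 2 - B * z ^ 2, by linear_combination -heq⟩
    have hz : z ≠ 0 := right_ne_zero_of_mul hZ
    refine ih z.natAbs ?_ x y z hz ?_ ?_ rfl
    · rw [← hk, Int.natAbs_mul]
      have h1 : 1 < q.natAbs := (Int.prime_iff_natAbs_prime.1 hq).one_lt
      have h2 : 0 < z.natAbs := Int.natAbs_pos.2 hz
      nlinarith
    · refine mul_left_cancel₀ (pow_ne_zero 2 hq.ne_zero) ?_
      linear_combination heq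
    · refine (hfn.of_isCoprime_of_dvd_left hqf).symm.dvd_of_dvd_mul_left ?_
      rwa [show q * (x - r * y) = q * x - r * (q * y) by ring]

theorem exists_sign_isCoprime (f : ℕ) (hf : Odd f) (U V : ℤ)
    (h : ∀ q, Prime q → q ∣ (f : ℤ) → ¬ (q ∣ U ∧ q ∣ V)) :
    ∃ e : ℤ, (f : ℤ) ∣ e ^ 2 - 1 ∧ IsCoprime (U + e * V) f := by
  induction f using Nat.recOnPosPrimePosCoprime with
  | zero => simp at hf
  | one => exact ⟨1, by simp, by simpa using isCoprime_one_right⟩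
  | prime_pow p k hp hk =>
    have hpp := Nat.prime_iff_prime_int.1 hp
    have hp2 : p ≠ 2 := by
      rintro rfl
      exact (Nat.not_odd_iff_even.2 ((Nat.even_pow' hk.ne').2 even_two)) hf
    have hcop : ∀ x : ℤ, ¬ (p : ℤ) ∣ x → IsCoprime x ((p ^ k : ℕ) : ℤ) := fun x hx => by
      push_cast
      exact (((Irreducible.coprime_iff_not_dvd hpp.irreducible).2 hx).symm).pow_right
    by_cases h1 : (p : ℤ) ∣ U + V
    · refine ⟨-1, by simp, hcop _ fun h2 => ?_⟩
      have hnd : ¬ (p : ℤ) ∣ 2 := fun h => by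
        have := (Nat.prime_dvd_prime_iff_eq hp Nat.prime_two).1 (by exact_mod_cast h)
        exact hp2 this
      refine h p hpp (by push_cast; exact dvd_pow_self _ hk.ne') ⟨?_, ?_⟩
      · refine (hpp.dvd_or_dvd (a := 2) (b := U) ?_).resolve_left hnd
        convert h1.add h2 using 1; ring
      · refine (hpp.dvd_or_dvd (a := 2) (b := V) ?_).resolve_left hnd
        convert h1.sub h2 using 1; ring
    · exact ⟨1, by simp, hcop _ (by simpa using h1)⟩
  | coprime a b ha hb hab iha ihb =>
    obtain ⟨e, he, hec⟩ := iha (Nat.odd_mul.1 hf).1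
      fun q hq hd => h q hq (hd.trans (Dvd.intro _ (by push_cast; rfl)))
    obtain ⟨g, hg, hgc⟩ := ihb (Nat.odd_mul.1 hf).2
      fun q hq hd => h q hq (hd.trans (Dvd.intro_left _ (by push_cast; rfl)))
    have hab' := Nat.isCoprime_iff_coprime.2 hab
    obtain ⟨i, j, hij⟩ := hab'
    refine ⟨e + (g - e) * (i * a), ?_, ?_⟩
    · push_cast
      refine IsCoprime.mul_dvd ⟨i, j, hij⟩ ?_ ?_
      · obtain ⟨k, hk⟩ := he
        exact ⟨k + (g - e) * i * (2 * e + (g - e) * (i * a)), by linear_combination hk⟩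
      · obtain ⟨k, hk⟩ := hg
        refine ⟨k - (g - e) * j * (2 * g - (g - e) * (j * b)), ?_⟩
        rw [show e + (g - e) * (i * a) = g - (g - e) * (j * b) by linear_combination (g - e) * hij]
        linear_combination hk
    · push_cast
      refine IsCoprime.mul_right ?_ ?_
      · rw [show U + (e + (g - e) * (i * a)) * V = U + e * V + a * ((g - e) * i * V) by ring]
        exact hec.add_mul_left_left _
      · rw [show U + (e + (g - e) * (i * a)) * V = U + g * V + b * (-(g - e) * j * V) by
          linear_combination (g - e) * V * hij]
        exact hgc.add_mul_left_left _

theorem conic_solution_adjust {A n p f e r X Y Z : ℤ} (hA : ¬ IsSquare A)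
    (hnp : ¬ IsSquare (n * p)) (hZ : Z ≠ 0) (heq : X ^ 2 - A * Y ^ 2 = n * p * Z ^ 2)
    (hr : n ∣ X - r * Y) (he : f ∣ e ^ 2 - 1) (hpn : f ∣ p - n) (h2n : IsCoprime (2 * n) f)
    (hc : IsCoprime (X + e * (n * Z)) f) :
    ∃ X' Y' Z' : ℤ, Z' ≠ 0 ∧ X' ^ 2 - A * (f * Y') ^ 2 = n * p * Z' ^ 2 ∧
      n ∣ X' - r * (f * Y') ∧ IsCoprime X' f := by
  obtain ⟨k, hk⟩ := he
  obtain ⟨l, hl⟩ := hpn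
  have hd : e ^ 2 * p - n = f * (k * p + l) := by linear_combination p * hk + hl
  refine ⟨(e ^ 2 * p + n) * X + 2 * e * n * p * Z, (k * p + l) * Y,
    e ^ 2 * p * Z + 2 * e * X + n * Z, ?_, ?_, ?_, ?_⟩
  · intro h0
    have hY : Y = 0 := eq_zero_of_sq_eq_mul_sq hA (X := e * p * Z + X)
      (by linear_combination p * Z * h0 + heq)
    subst hY
    exact hZ (eq_zero_of_sq_eq_mul_sq hnp (X := X) (by linear_combination heq))
  · rw [← mul_assoc, ← hd]
    linear_combination (e ^ 2 * p - n) ^ 2 * heq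
  · rw [← mul_assoc f, ← hd]
    obtain ⟨t, ht⟩ := hr
    exact ⟨e ^ 2 * p * t + X + r * Y + 2 * e * p * Z, by linear_combination e ^ 2 * p * ht⟩
  · rw [show (e ^ 2 * p + n) * X + 2 * e * n * p * Z =
      2 * n * (X + e * (n * Z)) + f * ((k * p + l) * X + 2 * e * n * l * Z) by
        linear_combination X * hd + 2 * e * n * Z * hl]
    exact (h2n.mul_left hc).add_mul_left_left _

theorem exists_sqrt_mod_mul {a n p f b s : ℤ} (hfn : IsCoprime f n) (hnp : IsCoprime n p)
    (hb : n ∣ b ^ 2 - a * f ^ 2) (hs : p ∣ s ^ 2 - a) :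
    ∃ r : ℤ, n * p ∣ r ^ 2 - a ∧ n ∣ r * f - b := by
  obtain ⟨i, j, hij⟩ := hfn
  obtain ⟨k, l, hkl⟩ := hnp
  obtain ⟨u, hu⟩ := hb
  obtain ⟨v, hv⟩ := hs
  have h1 : b * i * (l * p) + s * (k * n) = b * i + n * (k * (s - b * i)) := by
    linear_combination b * i * hkl
  have h2 : b * i * (l * p) + s * (k * n) = s + p * (l * (b * i - s)) := by
    linear_combination s * hkl
  refine ⟨b * i * (l * p) + s * (k * n), IsCoprime.mul_dvd ⟨k, l, hkl⟩ ?_ ?_, ?_⟩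
  · rw [h1]
    exact ⟨i ^ 2 * u - a * j * (1 + i * f) + k * (s - b * i) * (2 * (b * i) + n * (k * (s - b * i))),
      by linear_combination i ^ 2 * hu + a * (1 + i * f) * hij⟩
  · rw [h2]
    exact ⟨v + l * (b * i - s) * (2 * s + p * (l * (b * i - s))), by linear_combination hv⟩
  · rw [h1]
    exact ⟨-b * j + k * (s - b * i) * f, by linear_combination b * hij⟩

/-- A form `nx² + 2bxy + cy²` of discriminant `8Df²` primitively represents a value `u² + 2v²`
coprime to `2Df²`. -/
theorem exists_primitive_rep {D f n : ℕ} (hD0 : 0 < D) (hsf : Squarefree D) (hD4 : D % 4 = 1)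
    (hf : Odd f) (hn0 : 0 < n) {b c : ℤ} (hbc : b ^ 2 - n * c = 2 * (D : ℤ) * f ^ 2)
    (hc : IsCoprime (n : ℤ) (2 * (D : ℤ) * f ^ 2)) :
    ∃ x y u v : ℤ, IsCoprime x y ∧ n * x ^ 2 + 2 * b * x * y + c * y ^ 2 = u ^ 2 + 2 * v ^ 2 ∧
      IsCoprime (u ^ 2 + 2 * v ^ 2) (2 * (D : ℤ) * f ^ 2) := by
  have hn2 : IsCoprime (n : ℤ) 2 := hc.of_isCoprime_of_dvd_right ⟨(D : ℤ) * f ^ 2, by ring⟩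
  have hnf : IsCoprime (n : ℤ) f := hc.of_isCoprime_of_dvd_right ⟨2 * (D : ℤ) * f, by ring⟩
  have hnDf : IsCoprime (n : ℤ) ((D : ℤ) * f) := hc.of_isCoprime_of_dvd_right ⟨2 * (f : ℤ), by ring⟩
  have hnD2 : IsCoprime (n : ℤ) (2 * (D : ℤ)) := hc.of_isCoprime_of_dvd_right ⟨(f : ℤ) ^ 2, by ring⟩
  have hnodd : Odd n := by exact_mod_cast Int.isCoprime_two_right.1 hn2
  have hJ : J(2 * D | n) = 1 := by
    have h1 : J(2 * (D : ℤ) * f ^ 2 | n) = J(b ^ 2 | n) := jacobiSym.mod_left'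
      (Int.emod_eq_emod_iff_emod_sub_eq_zero.2 (Int.emod_eq_zero_of_dvd
        ⟨-c, by linear_combination -hbc⟩))
    have hbn : IsCoprime b n := by
      have : IsCoprime (b ^ 2) (n : ℤ) := by
        rw [show b ^ 2 = 2 * (D : ℤ) * f ^ 2 + n * c by linarith]
        exact hc.symm.add_mul_left_left c
      exact (IsCoprime.pow_left_iff two_pos).1 this
    rw [jacobiSym.mul_left, jacobiSym.sq_one' (Int.isCoprime_iff_gcd_eq_one.1 hnf.symm),
      jacobiSym.sq_one' (Int.isCoprime_iff_gcd_eq_one.1 hbn), mul_one] at h1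
    exact h1
  obtain ⟨p, hp, hp8, hgt, hpDf, hJp⟩ := exists_prime_of_genus hD0 hD4 hf hnodd hnDf hJ
  have hpp := Nat.prime_iff_prime_int.1 hp
  have hDsq : Squarefree (2 * D : ℤ) := by
    have h2 : Nat.Coprime 2 D := (Nat.coprime_two_left).2 (Nat.odd_iff.2 (by omega))
    have := (Nat.squarefree_mul h2).2 ⟨Nat.prime_two.squarefree, hsf⟩
    exact_mod_cast Int.squarefree_natCast.2 this
  have hpn : IsCoprime (n : ℤ) p := Nat.isCoprime_iff_coprime.2
    (Nat.coprime_of_lt_prime hn0.ne' (by omega) hp).symm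
  have hpm : IsCoprime (p : ℤ) (2 * (D : ℤ) * f) := by
    have : IsCoprime (p : ℤ) ((2 * D * f : ℕ) : ℤ) := Nat.isCoprime_iff_coprime.2
      (Nat.coprime_of_lt_prime (by have := hf.pos; positivity) (by omega) hp)
    exact_mod_cast this
  have hpD2 : IsCoprime (p : ℤ) (2 * (D : ℤ)) := hpm.of_isCoprime_of_dvd_right ⟨f, by ring⟩
  have hA : ¬ IsSquare ((2 * D : ℕ) : ℤ) := by
    rintro ⟨t, ht⟩
    push_cast at ht
    have h2 : Even (t * t) := ⟨D, by linarith⟩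
    obtain ⟨s, rfl⟩ : Even t := by simpa [Int.even_mul] using h2
    have : (D : ℤ) = 2 * (s * s) := by linarith
    omega
  have hnsq : ∀ k : ℤ, ¬ (p : ℤ) ∣ k → ¬ IsSquare (k * p) := by
    rintro k hk ⟨t, ht⟩
    have : (p : ℤ) ∣ t := by
      have : (p : ℤ) ∣ t * t := ⟨k, by rw [← ht]; ring⟩
      exact (hpp.dvd_or_dvd this).elim id id
    obtain ⟨s, rfl⟩ := this
    exact hk ⟨s * s, mul_right_cancel₀ hpp.ne_zero (by linear_combination ht)⟩
  have hpn' : ¬ (p : ℤ) ∣ n := (Irreducible.coprime_iff_not_dvd hpp.irreducible).1 hpn.symm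
  have hp2D' : ¬ (p : ℤ) ∣ 2 * D := (Irreducible.coprime_iff_not_dvd hpp.irreducible).1 hpD2
  have : Fact p.Prime := ⟨hp⟩
  obtain ⟨s, hs⟩ : ∃ s : ℤ, (p : ℤ) ∣ s ^ 2 - 2 * D := by
    obtain ⟨s, hs⟩ := ZMod.isSquare_of_jacobiSym_eq_one hJp
    refine ⟨s.val, ?_⟩
    rw [← ZMod.intCast_zmod_eq_zero_iff_dvd]
    push_cast at hs ⊢
    rw [ZMod.natCast_zmod_val, hs]
    ring
  obtain ⟨r, hr, hrf⟩ := exists_sqrt_mod_mul hnf.symm hpn (b := b) ⟨c, by linarith⟩ hs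
  have hns : ((2 * D : ℕ) : ℤ) ∣ (n : ℤ) ^ 2 - (n * p : ℕ) := by
    have h2 : (2 : ℤ) ∣ n * (n - p) := by
      have h := Nat.odd_iff.1 hnodd
      exact (show (2 : ℤ) ∣ n - p by omega).mul_left _
    have hD : (D : ℤ) ∣ n * (n - p) :=
      ((Dvd.intro (f : ℤ) rfl).trans hpDf |> (dvd_sub_comm).1).mul_left _
    have h2D : IsCoprime (2 : ℤ) D := Int.isCoprime_two_left.2
      (by exact_mod_cast Nat.odd_iff.2 (by omega : D % 2 = 1))
    push_cast
    rw [show (n : ℤ) ^ 2 - n * p = n * (n - p) by ring]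
    exact h2D.mul_dvd h2 hD
  have hsol := exists_conic_solution (A := 2 * D) (B := n * p) (by positivity)
    (Nat.mul_pos hn0 hp.pos) (by push_cast; exact (hnD2.mul_left hpD2).symm) hA
    (by
      have := hnsq (2 * D * n) fun h => (hpp.dvd_or_dvd h).elim hp2D' hpn'
      push_cast
      rwa [show (2 * D * (n * p) : ℤ) = 2 * D * n * p by ring])
    (r := r) (s := n) (by exact_mod_cast hr) hns
  push_cast at hsol hA
  have hsol' : ∃ X Y Z : ℤ, Z ≠ 0 ∧ X ^ 2 - 2 * D * Y ^ 2 = n * p * Z ^ 2 ∧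
      (n : ℤ) ∣ X - r * Y := by
    obtain ⟨X, Y, Z, h1, h2, h3⟩ := hsol
    exact ⟨X, Y, Z, h1, h2, (Dvd.intro _ rfl).trans h3⟩
  obtain ⟨X, Y, Z, hZ, heq, hd, hprim⟩ :=
    exists_conic_solution_primitive_at hDsq hnf.symm hsol'
  have h2nf : IsCoprime (2 * n : ℤ) f := IsCoprime.mul_left
    (Int.isCoprime_two_left.2 (by exact_mod_cast hf)) hnf
  obtain ⟨e, he, hec⟩ := exists_sign_isCoprime f hf X (n * Z) fun q hq hqf h =>
    hprim q hq hqf ⟨h.1, (hq.dvd_or_dvd h.2).resolve_left fun hqn =>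
      hq.not_isUnit (hnf.isUnit_of_dvd' hqn hqf)⟩
  obtain ⟨X, Y, Z, hZ, heq, ⟨t, ht⟩, hXf⟩ := conic_solution_adjust hA (hnsq n hpn') hZ heq hd he
    ((Dvd.intro_left (D : ℤ) rfl).trans hpDf) h2nf hec
  obtain ⟨w, hw⟩ := hrf
  clear hprim hec he hd hsol hsol'
  obtain ⟨x₁, rfl⟩ : ∃ x₁, X = n * x₁ + b * Y :=
    ⟨t + w * Y, by linear_combination ht + Y * hw⟩
  have hn0' : (n : ℤ) ≠ 0 := by exact_mod_cast hn0.ne'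
  have hQ : n * x₁ ^ 2 + 2 * b * x₁ * Y + c * Y ^ 2 = p * Z ^ 2 :=
    mul_left_cancel₀ hn0' (by linear_combination heq - Y ^ 2 * hbc)
  have hne : x₁ ≠ 0 ∨ Y ≠ 0 := by
    by_contra! h
    rw [h.1, h.2] at hQ
    have : (p : ℤ) * Z ^ 2 ≠ 0 := mul_ne_zero hpp.ne_zero (pow_ne_zero 2 hZ)
    exact this (by linear_combination -hQ)
  obtain ⟨g, x, y, hg, hxy, rfl, rfl⟩ :
      ∃ g x y : ℤ, g ≠ 0 ∧ IsCoprime x y ∧ x₁ = g * x ∧ Y = g * y := by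
    have hg : 0 < Int.gcd x₁ Y := Int.gcd_pos_iff.2 hne
    obtain ⟨x, y, h1, h2, h3⟩ := Int.exists_gcd_one hg
    exact ⟨Int.gcd x₁ Y, x, y, by exact_mod_cast hg.ne', Int.isCoprime_iff_gcd_eq_one.2 h1,
      by rw [mul_comm]; exact h2, by rw [mul_comm]; exact h3⟩
  obtain ⟨k, hk⟩ : g ∣ p * Z := (Int.pow_dvd_pow_iff two_ne_zero).1
    ⟨p * (n * x ^ 2 + 2 * b * x * y + c * y ^ 2), by linear_combination -(p : ℤ) * hQ⟩
  have hNk : (n * x ^ 2 + 2 * b * x * y + c * y ^ 2) * p = k ^ 2 :=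
    mul_left_cancel₀ (pow_ne_zero 2 hg)
      (by linear_combination p * hQ + (p * Z + g * k) * hk)
  obtain ⟨k, rfl⟩ : (p : ℤ) ∣ k := hpp.dvd_of_dvd_pow (Dvd.intro_left _ hNk)
  have hN : n * x ^ 2 + 2 * b * x * y + c * y ^ 2 = p * k ^ 2 :=
    mul_right_cancel₀ hpp.ne_zero (by linear_combination hNk)
  obtain ⟨u, v, huv⟩ := prime_eq_sq_add_two_mul_sq p hp hp8
  have hN' : (u * k) ^ 2 + 2 * (v * k) ^ 2 = p * k ^ 2 := by rw [huv]; ring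
  refine ⟨x, y, u * k, v * k, hxy, by rw [hN, hN'], ?_⟩
  rw [hN']
  refine isCoprime_of_prime_dvd ?_ ?_
  · rintro ⟨-, h⟩
    have := hf.pos
    exact absurd h (by positivity)
  · intro q hq hqN hqm
    have hn1 : n * (p * k ^ 2) = (n * x + b * y) ^ 2 - 2 * (D : ℤ) * f ^ 2 * y ^ 2 := by
      linear_combination (-(n : ℤ)) * hN - y ^ 2 * hbc
    have hqX : q ∣ n * x + b * y := by
      refine hq.dvd_of_dvd_pow (n := 2) ?_
      rw [show (n * x + b * y) ^ 2 = n * (p * k ^ 2) + 2 * (D : ℤ) * f ^ 2 * y ^ 2 by linarith]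
      exact (hqN.mul_left _).add (hqm.mul_right _)
    by_cases hqf : q ∣ (f : ℤ)
    · refine hq.not_isUnit (hXf.isUnit_of_dvd' ?_ hqf)
      rw [show n * (g * x) + b * (g * y) = g * (n * x + b * y) by ring]
      exact hqX.mul_left g
    · have hq2D : q ∣ 2 * D :=
        (hq.dvd_or_dvd hqm).resolve_right fun h => hqf (hq.dvd_of_dvd_pow h)
      have hqk : q ∣ k := hq.dvd_of_dvd_pow ((hq.dvd_or_dvd hqN).resolve_left fun h =>
        hq.not_isUnit (hpD2.isUnit_of_dvd' h hq2D))
      have hqy : q ∣ y := by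
        have : q ∣ f * y := dvd_of_sq_dvd_squarefree_mul_sq hDsq hq (by
          rw [show 2 * D * (f * y) ^ 2 = (n * x + b * y) ^ 2 - n * (p * k ^ 2) by linarith]
          exact (pow_dvd_pow_of_dvd hqX 2).sub
            (((pow_dvd_pow_of_dvd hqk 2).mul_left _).mul_left _))
        exact (hq.dvd_or_dvd this).resolve_left hqf
      have hqx : q ∣ x := by
        have : q ∣ n * x := by simpa using hqX.sub (hqy.mul_left b)
        exact (hq.dvd_or_dvd this).resolve_left fun h =>
          hq.not_isUnit (hnD2.isUnit_of_dvd' h hq2D)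
      exact hq.not_isUnit (hxy.isUnit_of_dvd' hqx hqy)

theorem s2D_sq (D : ℕ) : s2D D ^ 2 = 2 * D := by
  rw [s2D, ← Complex.ofReal_pow, Real.sq_sqrt (by positivity)]
  push_cast
  rfl

theorem sm2_sq : sm2 ^ 2 = -2 := by
  rw [sm2, mul_pow, Complex.I_sq, ← Complex.ofReal_pow, Real.sq_sqrt (by norm_num)]
  norm_num

theorem conj_s2D (D : ℕ) : starRingEnd ℂ (s2D D) = s2D D := Complex.conj_ofReal _

theorem conj_sm2 : starRingEnd ℂ sm2 = -sm2 := by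
  simp [sm2]

theorem mem_Rpf {D f : ℕ} {x : ℂ} :
    x ∈ Rpf D f ↔ ∃ i j : ℤ, x = i + j * (f * s2D D) := by
  have hs := s2D_sq D
  refine ⟨fun hx => ?_, ?_⟩
  · induction hx using Subring.closure_induction with
    | mem x hx => exact ⟨0, 1, by rw [hx]; push_cast; ring⟩
    | zero => exact ⟨0, 0, by simp⟩
    | one => exact ⟨1, 0, by simp⟩
    | add x y _ _ hx hy =>
      obtain ⟨i, j, rfl⟩ := hx
      obtain ⟨k, l, rfl⟩ := hy
      exact ⟨i + k, j + l, by push_cast; ring⟩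
    | neg x _ hx =>
      obtain ⟨i, j, rfl⟩ := hx
      exact ⟨-i, -j, by push_cast; ring⟩
    | mul x y _ _ hx hy =>
      obtain ⟨i, j, rfl⟩ := hx
      obtain ⟨k, l, rfl⟩ := hy
      exact ⟨i * k + 2 * D * f ^ 2 * (j * l), i * l + j * k, by
        push_cast
        linear_combination (j * l * f ^ 2 : ℂ) * hs⟩
  · rintro ⟨i, j, rfl⟩
    exact add_mem (intCast_mem _ i)
      (mul_mem (intCast_mem _ j) (Subring.subset_closure rfl))

theorem not_isSquare_two_mul {D : ℕ} (hD4 : D % 4 = 1) : ¬ IsSquare (2 * D : ℤ) := by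
  rintro ⟨t, ht⟩
  have h2 : Even (t * t) := ⟨D, by linarith⟩
  obtain ⟨s, rfl⟩ : Even t := by simpa [Int.even_mul] using h2
  have : (D : ℤ) = 2 * (s * s) := by linarith
  omega

theorem rat_eq_zero_of_sq_eq {D : ℕ} (hD4 : D % 4 = 1) {r s : ℚ} (h : r ^ 2 = 2 * D * s ^ 2) :
    r = 0 ∧ s = 0 := by
  have hs : s = 0 := by
    by_contra hs
    have h1 : IsSquare ((2 * D : ℤ) : ℚ) :=
      ⟨r / s, by push_cast; field_simp; linarith⟩
    exact not_isSquare_two_mul hD4 (Rat.isSquare_intCast_iff.1 h1)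
  subst hs
  exact ⟨by simpa using h, rfl⟩

theorem rat_add_mul_s2D_eq_zero {D : ℕ} (hD4 : D % 4 = 1) {r s : ℚ}
    (h : (r : ℂ) + s * s2D D = 0) : r = 0 ∧ s = 0 := by
  refine rat_eq_zero_of_sq_eq hD4 ?_
  have : (r : ℂ) ^ 2 = 2 * D * s ^ 2 := by
    linear_combination ((r : ℂ) - s * s2D D) * h + (s : ℂ) ^ 2 * s2D_sq D
  exact_mod_cast this

theorem int_coords_unique {D f : ℕ} (hD4 : D % 4 = 1) (hf : 0 < f) {i j k l : ℤ}
    (h : (i : ℂ) + j * (f * s2D D) = k + l * (f * s2D D)) : i = k ∧ j = l := by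
  have := rat_add_mul_s2D_eq_zero hD4 (r := (i - k : ℤ)) (s := ((j - l) * f : ℤ))
    (by push_cast; linear_combination h)
  have hf' : (f : ℤ) ≠ 0 := by exact_mod_cast hf.ne'
  have h1 : i - k = 0 := by exact_mod_cast this.1
  have h2 : (j - l) * f = 0 := by exact_mod_cast this.2
  have h3 := (mul_eq_zero.1 h2).resolve_right hf'
  omega

theorem mem_Kp {D : ℕ} {x : ℂ} : x ∈ Kp D ↔ ∃ r s : ℚ, x = r + s * s2D D := by
  have hs := s2D_sq D
  refine ⟨fun hx => ?_, ?_⟩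
  · induction hx using IntermediateField.adjoin_induction with
    | mem x hx => exact ⟨0, 1, by rw [hx]; simp⟩
    | algebraMap x => exact ⟨x, 0, by simp⟩
    | add x y _ _ hx hy =>
      obtain ⟨i, j, rfl⟩ := hx
      obtain ⟨k, l, rfl⟩ := hy
      exact ⟨i + k, j + l, by push_cast; ring⟩
    | inv x _ hx =>
      obtain ⟨i, j, rfl⟩ := hx
      by_cases h0 : (i : ℂ) + j * s2D D = 0
      · exact ⟨0, 0, by simp [h0]⟩
      by_cases h1 : (i : ℂ) - j * s2D D = 0
      · refine ⟨1 / (2 * i), 0, ?_⟩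
        have : (i : ℂ) + j * s2D D = 2 * i := by linear_combination -h1
        rw [this]
        simp
      · refine ⟨i / (i ^ 2 - 2 * D * j ^ 2), -j / (i ^ 2 - 2 * D * j ^ 2), ?_⟩
        have h2 : (i : ℂ) ^ 2 - 2 * D * j ^ 2 = (i + j * s2D D) * (i - j * s2D D) := by
          linear_combination (j : ℂ) ^ 2 * hs
        push_cast
        rw [h2]
        field_simp
        ring
    | mul x y _ _ hx hy =>
      obtain ⟨i, j, rfl⟩ := hx
      obtain ⟨k, l, rfl⟩ := hy
      exact ⟨i * k + 2 * D * (j * l), i * l + j * k, by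
        push_cast
        linear_combination (j * l : ℂ) * hs⟩
  · rintro ⟨r, s, rfl⟩
    exact add_mem (SubfieldClass.ratCast_mem _ r) (mul_mem (SubfieldClass.ratCast_mem _ s)
      (IntermediateField.mem_adjoin_simple_self ℚ _))

/-- `t = r + s√(2D)` with positive norm `r² - 2Ds²`. -/
def PosNorm (D : ℕ) (t : ℂ) : Prop :=
  ∃ r s : ℚ, t = r + s * s2D D ∧ 0 < r ^ 2 - 2 * D * s ^ 2

theorem PosNorm.mul {D : ℕ} {t t' : ℂ} (h : PosNorm D t) (h' : PosNorm D t') :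
    PosNorm D (t * t') := by
  obtain ⟨r, s, rfl, h⟩ := h
  obtain ⟨r', s', rfl, h'⟩ := h'
  refine ⟨r * r' + 2 * D * (s * s'), r * s' + s * r', ?_, ?_⟩
  · push_cast
    linear_combination (s * s' : ℂ) * s2D_sq D
  · rw [show (r * r' + 2 * D * (s * s')) ^ 2 - 2 * D * (r * s' + s * r') ^ 2
      = (r ^ 2 - 2 * D * s ^ 2) * (r' ^ 2 - 2 * D * s' ^ 2) by ring]
    exact mul_pos h h'

theorem PosNorm.div_intCast {D : ℕ} {t : ℂ} (h : PosNorm D t) {c : ℤ} (hc : c ≠ 0) :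
    PosNorm D (t / c) := by
  obtain ⟨r, s, rfl, h⟩ := h
  refine ⟨r / c, s / c, by push_cast; ring, ?_⟩
  have : (c : ℚ) ≠ 0 := by exact_mod_cast hc
  rw [show (r / c) ^ 2 - 2 * D * (s / c) ^ 2 = (r ^ 2 - 2 * D * s ^ 2) / (c : ℚ) ^ 2 by
    field_simp]
  positivity

/-- Up to sign, an element of positive norm is totally positive. -/
theorem PosNorm.exists_totally_positive {D : ℕ} {t : ℂ} (h : PosNorm D t) :
    ∃ t' : Kp D, ((t' : ℂ) = t ∨ (t' : ℂ) = -t) ∧ t' ≠ 0 ∧ ∀ φ : Kp D →+* ℝ, 0 < φ t' := by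
  obtain ⟨r, s, rfl, h⟩ := h
  wlog hr : 0 ≤ r generalizing r s
  · obtain ⟨t', h1, h2⟩ := this (-r) (-s) (by simpa using h) (by linarith)
    refine ⟨t', h1.symm.imp ?_ ?_, h2⟩ <;> intro h <;> rw [h] <;> push_cast <;> ring
  have hpos : ∀ φ : Kp D →+* ℝ, 0 < φ ⟨r + s * s2D D, mem_Kp.2 ⟨r, s, rfl⟩⟩ := by
    intro φ
    let σ : Kp D := ⟨s2D D, IntermediateField.mem_adjoin_simple_self ℚ _⟩
    have hσ : σ ^ 2 = 2 * D := Subtype.ext (by push_cast; exact s2D_sq D)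
    have ht : (⟨r + s * s2D D, mem_Kp.2 ⟨r, s, rfl⟩⟩ : Kp D) = r + s * σ :=
      Subtype.ext (by push_cast; rfl)
    have hφ : (φ σ) ^ 2 = 2 * D := by
      rw [← map_pow, hσ, map_mul, map_natCast, map_ofNat]
    rw [ht]
    simp only [map_add, map_mul, map_ratCast]
    have h' : (0 : ℝ) < r ^ 2 - 2 * D * s ^ 2 := by exact_mod_cast h
    have hr' : (0 : ℝ) ≤ r := by exact_mod_cast hr
    have : |(s : ℝ) * φ σ| < r := abs_lt_of_sq_lt_sq (by rw [mul_pow, hφ]; linarith) hr'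
    linarith [neg_abs_le ((s : ℝ) * φ σ)]
  refine ⟨⟨r + s * s2D D, mem_Kp.2 ⟨r, s, rfl⟩⟩, Or.inl rfl, ?_, hpos⟩
  intro h0
  have h1 : (r : ℂ) + s * s2D D = 0 := congrArg Subtype.val h0
  have h2 : (r : ℂ) ^ 2 - 2 * D * s ^ 2 = 0 := by
    linear_combination ((r : ℂ) - s * s2D D) * h1 + (s : ℂ) ^ 2 * s2D_sq D
  exact h.ne' (by exact_mod_cast h2)

/-- If no single subgroup `bad q` with `q ∈ S` contains `H`, and `q • H ⊆ bad q`, then some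
element of `H` avoids all of them simultaneously. -/
theorem exists_mem_forall_notMem {M : Type*} [AddCommGroup M] (H : AddSubgroup M)
    (bad : ℕ → AddSubgroup M) (S : Finset ℕ) (hS : ∀ q ∈ S, q.Prime)
    (hmul : ∀ q ∈ S, ∀ h ∈ H, q • h ∈ bad q) (hex : ∀ q ∈ S, ∃ h ∈ H, h ∉ bad q) :
    ∃ h ∈ H, ∀ q ∈ S, h ∉ bad q := by
  induction S using Finset.induction_on with
  | empty => exact ⟨0, H.zero_mem, by simp⟩
  | insert p S hp ih =>
    simp only [Finset.forall_mem_insert] at hS hmul hex ⊢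
    obtain ⟨x, hx, hxS⟩ := ih hS.2 hmul.2 hex.2
    by_cases hxp : x ∈ bad p
    · obtain ⟨y, hy, hyp⟩ := hex.1
      set P := ∏ q ∈ S, q with hP
      have hcop : IsCoprime (P : ℤ) p := by
        rw [Nat.isCoprime_iff_coprime, hP]
        refine Nat.Coprime.prod_left fun q hq => ?_
        exact (Nat.coprime_primes (hS.2 q hq) hS.1).2 fun h => hp (h ▸ hq)
      refine ⟨x + P • y, add_mem hx (H.nsmul_mem hy P), fun h => hyp ?_, fun q hq h => hxS q hq ?_⟩
      · have h1 : P • y ∈ bad p := by simpa using sub_mem h hxp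
        obtain ⟨a, b, hab⟩ := hcop
        have h2 : y = a • (P • y) + b • (p • y) := by
          rw [← natCast_zsmul, ← natCast_zsmul, smul_smul, smul_smul, ← add_smul, hab, one_smul]
        rw [h2]
        exact add_mem ((bad p).zsmul_mem h1 a) ((bad p).zsmul_mem (hmul.1 y hy) b)
      · have h1 : P • y ∈ bad q := by
          rw [hP, ← Finset.prod_erase_mul S (fun q => q) hq, mul_smul]
          exact (bad q).nsmul_mem (hmul.2 q hq y hy) _
        simpa using sub_mem h h1
    · exact ⟨x, hx, hxp, hxS⟩

/-- The elements `q·a + b·f√(2D)` with `a, b ∈ ℤ`. -/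
def multSubgroup (D f q : ℕ) : AddSubgroup ℂ where
  carrier := {x | ∃ a b : ℤ, x = q * a + b * (f * s2D D)}
  zero_mem' := ⟨0, 0, by simp⟩
  add_mem' := by
    rintro _ _ ⟨a, b, rfl⟩ ⟨c, d, rfl⟩
    exact ⟨a + c, b + d, by push_cast; ring⟩
  neg_mem' := by
    rintro _ ⟨a, b, rfl⟩
    exact ⟨-a, -b, by push_cast; ring⟩

theorem smul_mem_multSubgroup {D f : ℕ} (q : ℕ) {x : ℂ} (hx : x ∈ Rpf D f) :
    q • x ∈ multSubgroup D f q := by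
  obtain ⟨i, j, rfl⟩ := mem_Rpf.1 hx
  exact ⟨i, q * j, by rw [nsmul_eq_mul]; push_cast; ring⟩

theorem mul_mem_of_mem_subring {R : Subring ℂ} {M : Submodule R ℂ} {r x : ℂ} (hr : r ∈ R)
    (hx : x ∈ M) : r * x ∈ M :=
  M.smul_mem ⟨r, hr⟩ hx

theorem isCoprime_of_notMem {D f : ℕ} {m : ℕ} (hm : m ≠ 0) {i j : ℤ}
    (h : ∀ q ∈ m.primeFactors, (i : ℂ) + j * (f * s2D D) ∉ multSubgroup D f q) :
    IsCoprime i (m : ℤ) := by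
  rw [Int.isCoprime_iff_gcd_eq_one]
  by_contra hne
  obtain ⟨p, hp, hpd⟩ := Nat.exists_prime_and_dvd hne
  have hpm : p ∣ m := Int.natCast_dvd_natCast.1
    ((Int.natCast_dvd_natCast.2 hpd).trans (Int.gcd_dvd_right _ _))
  obtain ⟨a, rfl⟩ := (Int.natCast_dvd_natCast.2 hpd).trans (Int.gcd_dvd_left i m)
  exact h p (Nat.mem_primeFactors.2 ⟨hp, hpm, hm⟩) ⟨a, j, by push_cast; ring⟩

theorem exists_multiplier {D f : ℕ} (hD0 : 0 < D) (hD4 : D % 4 = 1) (hf0 : 0 < f)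
    {B : Submodule (Rpf D f) ℂ} (hBinv : ∃ B' : Submodule (Rpf D f) ℂ, B * B' = 1) :
    ∃ τ : ℂ, (∀ β ∈ B, τ * β ∈ Rpf D f) ∧ ∃ β ∈ B, ∃ i j : ℤ,
      τ * β = i + j * (f * s2D D) ∧ IsCoprime i (2 * (D : ℤ) * f ^ 2) := by
  obtain ⟨B', hB⟩ := hBinv
  set m : ℕ := 2 * D * f ^ 2 with hm
  have hm0 : m ≠ 0 := by positivity
  have hprod : ∀ b ∈ B, ∀ b' ∈ B', b * b' ∈ Rpf D f := by
    intro b hb b' hb'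
    have h := Submodule.mul_mem_mul hb hb'
    rw [hB, Submodule.mem_one] at h
    obtain ⟨r, hr⟩ := h
    rw [← hr]
    exact r.2
  have hone : ∀ q ∈ m.primeFactors, ∃ b' ∈ B', ∃ b ∈ B, b * b' ∉ multSubgroup D f q := by
    intro q hq
    by_contra! hall
    have h1 : (1 : ℂ) ∈ B * B' := by rw [hB]; exact Submodule.one_le.1 le_rfl
    have h2 : (1 : ℂ) ∈ multSubgroup D f q :=
      Submodule.mul_induction_on h1 (fun b hb b' hb' => hall b' hb' b hb)
        fun _ _ => add_mem
    obtain ⟨a, b, hab⟩ := h2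
    have h3 := (int_coords_unique (D := D) (f := f) (i := 1) (j := 0) (k := q * a) (l := b)
      hD4 hf0 (by push_cast; linear_combination hab)).1
    have := Int.eq_one_of_dvd_one (by positivity) ⟨a, h3⟩
    exact (Nat.prime_of_mem_primeFactors hq).one_lt.ne' (by exact_mod_cast this)
  let bad (q : ℕ) : AddSubgroup ℂ :=
    ⨅ b : B, (multSubgroup D f q).comap (AddMonoidHom.mulLeft (b : ℂ))
  have hbad : ∀ q x, x ∈ bad q ↔ ∀ b ∈ B, b * x ∈ multSubgroup D f q := by
    intro q x
    simp [bad, AddSubgroup.mem_iInf]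
  obtain ⟨τ, hτ, hτbad⟩ := exists_mem_forall_notMem B'.toAddSubgroup bad m.primeFactors
    (fun q => Nat.prime_of_mem_primeFactors)
    (fun q _ b' hb' => (hbad _ _).2 fun b hb => by
      rw [mul_smul_comm]
      exact smul_mem_multSubgroup q (hprod b hb b' hb'))
    (fun q hq => by
      obtain ⟨b', hb', b, hb, h⟩ := hone q hq
      exact ⟨b', hb', fun h' => h ((hbad _ _).1 h' b hb)⟩)
  obtain ⟨β, hβ, hβbad⟩ := exists_mem_forall_notMem B.toAddSubgroup
    (fun q => (multSubgroup D f q).comap (AddMonoidHom.mulRight τ)) m.primeFactors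
    (fun q => Nat.prime_of_mem_primeFactors)
    (fun q _ b hb => by
      simp only [AddSubgroup.mem_comap, AddMonoidHom.coe_mulRight]
      rw [smul_mul_assoc]
      exact smul_mem_multSubgroup q (hprod b hb τ hτ))
    (fun q hq => by
      have := hτbad q hq
      rw [hbad] at this
      push Not at this
      simpa using this)
  have hint : ∀ b ∈ B, τ * b ∈ Rpf D f := fun b hb => by
    rw [mul_comm]
    exact hprod b hb τ hτ
  obtain ⟨i, j, hij⟩ := mem_Rpf.1 (hint β hβ)
  refine ⟨τ, hint, β, hβ, i, j, hij, ?_⟩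
  have := isCoprime_of_notMem (D := D) (f := f) (i := i) (j := j) hm0 fun q hq => by
    have := hβbad q hq
    rw [← hij, mul_comm]
    simpa using this
  simpa [hm] using this

theorem ne_zero_of_isCoprime_two_mul {a b : ℤ} (h : IsCoprime a (2 * b)) : a ≠ 0 := by
  rintro rfl
  have h2 := isCoprime_zero_left.1 h.of_mul_right_left
  rw [Int.isUnit_iff] at h2
  omega

theorem exists_posNorm_multiplier {D f : ℕ} (hD0 : 0 < D) (hD4 : D % 4 = 1) (hf0 : 0 < f)
    {B : Submodule (Rpf D f) ℂ} (hBK : (B : Set ℂ) ⊆ Kp D)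
    (hBinv : ∃ B' : Submodule (Rpf D f) ℂ, B * B' = 1) :
    ∃ τ : ℂ, PosNorm D τ ∧ (∀ β ∈ B, τ * β ∈ Rpf D f) ∧ ∃ β ∈ B, ∃ i j : ℤ,
      τ * β = i + j * (f * s2D D) ∧ IsCoprime i (2 * (D : ℤ) * f ^ 2) := by
  obtain ⟨τ, hint, β, hβ, i, j, hij, hcop⟩ := exists_multiplier hD0 hD4 hf0 hBinv
  have hi : i ≠ 0 :=
    ne_zero_of_isCoprime_two_mul (b := D * f ^ 2) (by rwa [← mul_assoc])
  have hτβ : τ * β ≠ 0 := fun h => hi <| by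
    have := (int_coords_unique (D := D) (f := f) (i := i) (j := j) (k := 0) (l := 0)
      hD4 hf0 (by rw [← hij, h]; simp)).1
    simpa using this
  have hτ0 : τ ≠ 0 := left_ne_zero_of_mul hτβ
  have hβ0 : β ≠ 0 := right_ne_zero_of_mul hτβ
  have hτK : τ ∈ Kp D := by
    have h1 : τ * β ∈ Kp D := mem_Kp.2 ⟨i, j * f, by rw [hij]; push_cast; ring⟩
    have := div_mem h1 (hBK hβ)
    rwa [mul_div_cancel_right₀ _ hβ0] at this
  obtain ⟨r, s, hrs⟩ := mem_Kp.1 hτK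
  rcases lt_trichotomy (r ^ 2 - 2 * D * s ^ 2) 0 with h | h | h
  · refine ⟨τ * (1 + f * s2D D), ⟨r + 2 * D * f * s, r * f + s, ?_, ?_⟩, fun b hb => ?_, β, hβ,
      i + 2 * (D : ℤ) * f ^ 2 * j, i + j, ?_, ?_⟩
    · rw [hrs]
      push_cast
      linear_combination (s * f : ℂ) * s2D_sq D
    · rw [show (r + 2 * D * f * s) ^ 2 - 2 * D * (r * f + s) ^ 2
        = -(r ^ 2 - 2 * D * s ^ 2) * (2 * D * f ^ 2 - 1) by ring]
      refine mul_pos (by linarith) ?_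
      have : (1 : ℤ) ≤ D * f ^ 2 := by
        have : 0 < D * f ^ 2 := by positivity
        exact_mod_cast this
      have : (1 : ℚ) ≤ D * f ^ 2 := by exact_mod_cast this
      linarith
    · rw [mul_assoc, mul_comm (1 + _ : ℂ), ← mul_assoc]
      exact mul_mem (hint b hb) (mem_Rpf.2 ⟨1, 1, by push_cast; ring⟩)
    · rw [mul_right_comm, hij]
      push_cast
      linear_combination (j * f ^ 2 : ℂ) * s2D_sq D
    · exact IsCoprime.add_mul_left_left hcop j
  · obtain ⟨rfl, rfl⟩ := rat_eq_zero_of_sq_eq hD4 (sub_eq_zero.1 h)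
    exact absurd (by rw [hrs]; simp) hτ0
  · exact ⟨τ, ⟨r, s, hrs, h⟩, hint, β, hβ, i, j, hij, hcop⟩

/-- Every invertible ideal of `ℤ[f√(2D)]` is, up to a factor of positive norm, of the form
`nℤ + (b + f√(2D))ℤ` with `n` coprime to the discriminant. -/
theorem exists_normal_form {D f : ℕ} (hD0 : 0 < D) (hD4 : D % 4 = 1) (hf0 : 0 < f)
    {B : Submodule (Rpf D f) ℂ} (hBK : (B : Set ℂ) ⊆ Kp D)
    (hBinv : ∃ B' : Submodule (Rpf D f) ℂ, B * B' = 1) :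
    ∃ (t : ℂ) (n : ℕ) (b c : ℤ), 0 < n ∧ PosNorm D t ∧ b ^ 2 - n * c = 2 * (D : ℤ) * f ^ 2 ∧
      IsCoprime (n : ℤ) (2 * (D : ℤ) * f ^ 2) ∧
      (∀ β ∈ B, ∃ i k : ℤ, t * β = n * i + k * (b + f * s2D D)) ∧
      (∃ β ∈ B, t * β = n) ∧ ∃ β ∈ B, t * β = b + f * s2D D := by
  obtain ⟨τ, hτ, hint, β₀, hβ₀, i₀, j₀, hij₀, hcop⟩ :=
    exists_posNorm_multiplier hD0 hD4 hf0 hBK hBinv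
  have hs := s2D_sq D
  have hRp (i j : ℤ) {β : ℂ} (hβ : β ∈ B) : (i + j * (f * s2D D)) * β ∈ B :=
    mul_mem_of_mem_subring (mem_Rpf.2 ⟨i, j, rfl⟩) hβ
  let H₀ : AddSubgroup ℤ :=
    { carrier := {i | ∃ β ∈ B, τ * β = i}
      zero_mem' := ⟨0, B.zero_mem, by simp⟩
      add_mem' := by
        rintro i j ⟨β, hβ, h⟩ ⟨γ, hγ, h'⟩
        exact ⟨β + γ, add_mem hβ hγ, by push_cast; linear_combination h + h'⟩
      neg_mem' := by
        rintro i ⟨β, hβ, h⟩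
        exact ⟨-β, neg_mem hβ, by push_cast; linear_combination -h⟩ }
  let H₁ : AddSubgroup ℤ :=
    { carrier := {j | ∃ β ∈ B, ∃ i : ℤ, τ * β = i + j * (f * s2D D)}
      zero_mem' := ⟨0, B.zero_mem, 0, by simp⟩
      add_mem' := by
        rintro i j ⟨β, hβ, k, h⟩ ⟨γ, hγ, l, h'⟩
        exact ⟨β + γ, add_mem hβ hγ, k + l, by push_cast; linear_combination h + h'⟩
      neg_mem' := by
        rintro i ⟨β, hβ, k, h⟩
        exact ⟨-β, neg_mem hβ, -k, by push_cast; linear_combination -h⟩ }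
  obtain ⟨n', hn'⟩ := Int.subgroup_cyclic H₀
  obtain ⟨c, hc⟩ := Int.subgroup_cyclic H₁
  have mem₀ {i : ℤ} : (∃ β ∈ B, τ * β = i) ↔ n' ∣ i := by
    rw [← Int.mem_zmultiples_iff, AddSubgroup.zmultiples_eq_closure, ← hn']
    rfl
  have mem₁ {j : ℤ} : (∃ β ∈ B, ∃ i : ℤ, τ * β = i + j * (f * s2D D)) ↔ c ∣ j := by
    rw [← Int.mem_zmultiples_iff, AddSubgroup.zmultiples_eq_closure, ← hc]
    rfl
  have h01 {i : ℤ} (hi : n' ∣ i) : c ∣ i := by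
    obtain ⟨β, hβ, h⟩ := mem₀.2 hi
    exact mem₁.1 ⟨_, hRp 0 1 hβ, 0, by push_cast; linear_combination (f * s2D D : ℂ) * h⟩
  have hn0 : n' ∣ i₀ ^ 2 + 2 * (D : ℤ) * f ^ 2 * (-j₀ ^ 2) := mem₀.1 ⟨_, hRp i₀ (-j₀) hβ₀, by
    push_cast
    linear_combination (i₀ - j₀ * (f * s2D D) : ℂ) * hij₀ - (j₀ ^ 2 * f ^ 2 : ℂ) * hs⟩
  have hcop0 : IsCoprime n' (2 * (D : ℤ) * f ^ 2) :=
    ((hcop.pow_left (m := 2)).add_mul_left_left _).of_isCoprime_of_dvd_left hn0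
  obtain ⟨n₁, rfl⟩ := h01 dvd_rfl
  have hn0' : c * n₁ ≠ 0 :=
    ne_zero_of_isCoprime_two_mul (b := D * f ^ 2) (by rwa [← mul_assoc])
  have hc0 : c ≠ 0 := left_ne_zero_of_mul hn0'
  have hcC : (c : ℂ) ≠ 0 := by exact_mod_cast hc0
  obtain ⟨β₁, hβ₁, i₁, h₁⟩ := mem₁.2 (dvd_refl c)
  obtain ⟨b, rfl⟩ : c ∣ i₁ := mem₁.1 ⟨_, hRp 0 1 hβ₁, c * (2 * D * f ^ 2), by
    push_cast
    linear_combination (f * s2D D : ℂ) * h₁ + (c * f ^ 2 : ℂ) * hs⟩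
  push_cast at h₁
  have hdvd : n₁ ∣ b ^ 2 - 2 * D * f ^ 2 := by
    refine (mul_dvd_mul_iff_left hc0).1 (mem₀.1 ⟨_, hRp b (-1) hβ₁, ?_⟩)
    push_cast
    linear_combination (b - f * s2D D : ℂ) * h₁ - (c * f ^ 2 : ℂ) * hs
  obtain ⟨c', hc'⟩ := Int.natAbs_dvd.2 hdvd
  refine ⟨τ / c, n₁.natAbs, b, c', Int.natAbs_pos.2 (right_ne_zero_of_mul hn0'),
    hτ.div_intCast hc0, by linarith, ?_, ?_, ?_, β₁, hβ₁, ?_⟩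
  · exact hcop0.of_isCoprime_of_dvd_left (Int.natAbs_dvd.2 (dvd_mul_left _ _))
  · intro β hβ
    obtain ⟨i, j, hij⟩ := mem_Rpf.1 (hint β hβ)
    obtain ⟨k, rfl⟩ := mem₁.1 ⟨β, hβ, i, hij⟩
    push_cast at hij
    have hdvd' : c * n₁ ∣ i - c * (k * b) := mem₀.1
      ⟨_, add_mem hβ (hRp (-k) 0 hβ₁), by
        push_cast
        linear_combination hij - (k : ℂ) * h₁⟩
    obtain ⟨l, hl⟩ := (mul_dvd_mul_left c (Int.natAbs_dvd.2 dvd_rfl)).trans hdvd'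
    refine ⟨l, k, ?_⟩
    have hl' : (i : ℂ) - c * (k * b) = c * ((n₁.natAbs : ℕ) : ℤ) * l := by exact_mod_cast hl
    rw [Int.cast_natCast] at hl'
    field_simp
    linear_combination hij + hl'
  · obtain ⟨β, hβ, h⟩ := mem₀.2 (mul_dvd_mul_left c (Int.dvd_natAbs.2 (dvd_refl n₁)))
    refine ⟨β, hβ, ?_⟩
    rw [div_mul_eq_mul_div, h, Int.cast_mul, Int.cast_natCast, mul_div_cancel_left₀ _ hcC]
  · field_simp
    linear_combination h₁

theorem sm2_mem_Rf (D f : ℕ) : sm2 ∈ Rf D f :=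
  Subring.subset_closure (Set.mem_insert _ _)

theorem mul_s2D_mem_Rf (D f : ℕ) : (f : ℂ) * s2D D ∈ Rf D f := by
  have hw : (f : ℂ) * w D ∈ Rf D f := Subring.subset_closure (Set.mem_insert_of_mem _ rfl)
  rw [show (f : ℂ) * s2D D = (2 : ℤ) * (f * w D) - (f : ℤ) * sm2 by rw [w]; push_cast; ring]
  exact sub_mem (mul_mem (intCast_mem _ _) hw) (mul_mem (intCast_mem _ _) (sm2_mem_Rf D f))

theorem conj_mem_Rf {D f : ℕ} {x : ℂ} (hx : x ∈ Rf D f) : starRingEnd ℂ x ∈ Rf D f := by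
  induction hx using Subring.closure_induction with
  | mem x hx =>
    obtain rfl | rfl := hx
    · rw [conj_sm2]
      exact neg_mem (sm2_mem_Rf D f)
    · have hw : (f : ℂ) * w D ∈ Rf D f := Subring.subset_closure (Set.mem_insert_of_mem _ rfl)
      have : starRingEnd ℂ ((f : ℂ) * w D) = f * w D - (f : ℤ) * sm2 := by
        simp only [w, map_mul, map_div₀, map_add, conj_s2D, conj_sm2, map_natCast, map_ofNat]
        push_cast
        ring
      rw [this]
      exact sub_mem hw (mul_mem (intCast_mem _ _) (sm2_mem_Rf D f))
  | zero => simp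
  | one => simp
  | add x y _ _ hx hy => simpa using add_mem hx hy
  | neg x _ hx => simpa using neg_mem hx
  | mul x y _ _ hx hy => simpa using mul_mem hx hy

theorem s2D_mem_Kf (D : ℕ) : s2D D ∈ Kf D := by
  have h : s2D D = -(sm2 * smD D) := by
    rw [s2D, sm2, smD, Real.sqrt_mul (by norm_num)]
    push_cast
    linear_combination (Real.sqrt 2 * Real.sqrt D : ℂ) * Complex.I_sq
  rw [h]
  exact neg_mem (mul_mem (IntermediateField.subset_adjoin _ _ (by simp))
    (IntermediateField.subset_adjoin _ _ (by simp)))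

theorem mem_Kf_of_mem_Rf {D f : ℕ} {x : ℂ} (hx : x ∈ Rf D f) : x ∈ Kf D := by
  have h2 : sm2 ∈ Kf D := IntermediateField.subset_adjoin _ _ (by simp)
  suffices Rf D f ≤ (Kf D).toSubfield.toSubring from this hx
  refine Subring.closure_le.2 ?_
  rintro _ (rfl | rfl)
  · exact h2
  · change (f : ℂ) * ((s2D D + sm2) / 2) ∈ Kf D
    exact mul_mem (natCast_mem (Kf D) f)
      (div_mem (add_mem (s2D_mem_Kf D) h2) (ofNat_mem (Kf D) 2))

theorem conjSubmodule_span {D f : ℕ} (S : Set ℂ) :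
    conjSubmodule (Rf D f) (Submodule.span (Rf D f) S)
      = Submodule.span (Rf D f) (starRingEnd ℂ '' S) := by
  refine le_antisymm (Submodule.span_le.2 ?_)
    (Submodule.span_mono (Set.image_mono Submodule.subset_span))
  rintro _ ⟨x, hx, rfl⟩
  induction hx using Submodule.span_induction with
  | mem x hx => exact Submodule.subset_span ⟨x, hx, rfl⟩
  | zero => simp
  | add x y _ _ hx hy => simpa using add_mem hx hy
  | smul r x _ hx =>
    rw [show r • x = (r : ℂ) * x from rfl, map_mul]
    exact mul_mem_of_mem_subring (conj_mem_Rf r.2) hx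

/-- If `n` is represented by the form `(n, 2b, c)` of discriminant `8Df²` at `(x, y)` and the
value `u² + 2v²` is coprime to `2Df²`, then the ideal generated by `u + v√-2` and the generators
`E₁ = nx + by - yθ`, `E₂ = bx + cy + xθ` of an ideal of norm `u² + 2v²` (with `θ = f√(2D)`)
is invertible, with relative norm generated by `E₁` and `E₂`. -/
theorem exists_ideal_of_rep {D f : ℕ} {n b c x y u v : ℤ}
    (hbc : b ^ 2 - n * c = 2 * (D : ℤ) * f ^ 2) (hc : IsCoprime n (2 * (D : ℤ) * f ^ 2))
    (hxy : IsCoprime x y) (hrep : n * x ^ 2 + 2 * b * x * y + c * y ^ 2 = u ^ 2 + 2 * v ^ 2)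
    (hN : IsCoprime (u ^ 2 + 2 * v ^ 2) (2 * (D : ℤ) * f ^ 2)) (hN0 : u ^ 2 + 2 * v ^ 2 ≠ 0) :
    ∃ A : Submodule (Rf D f) ℂ, (A : Set ℂ) ⊆ Kf D ∧
      (∃ A' : Submodule (Rf D f) ℂ, A * A' = 1) ∧
      A * conjSubmodule (Rf D f) A = Submodule.span (Rf D f)
        {n * x + b * y - y * (f * s2D D), b * x + c * y + x * (f * s2D D)} := by
  have hs := s2D_sq D
  have hs2 := sm2_sq
  set R := Rf D f
  set θ : ℂ := f * s2D D with hθdef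
  have hθ : θ ^ 2 = b ^ 2 - n * c := by
    have : (b : ℂ) ^ 2 - n * c = 2 * D * f ^ 2 := by exact_mod_cast hbc
    rw [this, hθdef]
    linear_combination (f ^ 2 : ℂ) * hs
  have hθR : θ ∈ R := mul_s2D_mem_Rf D f
  have hR (i j : ℤ) : (i : ℂ) + j * θ ∈ R :=
    add_mem (intCast_mem _ _) (mul_mem (intCast_mem _ _) hθR)
  set N : ℂ := u ^ 2 + 2 * v ^ 2 with hNdef
  have hNC : N ≠ 0 := by rw [hNdef]; exact_mod_cast hN0
  have hNrep : (n : ℂ) * x ^ 2 + 2 * b * x * y + c * y ^ 2 = N := by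
    rw [hNdef]
    exact_mod_cast hrep
  set E₁ : ℂ := n * x + b * y - y * θ with hE₁
  set E₂ : ℂ := b * x + c * y + x * θ with hE₂
  set F₁ : ℂ := n * x + b * y + y * θ with hF₁
  set F₂ : ℂ := b * x + c * y - x * θ with hF₂
  have hE₁R : E₁ ∈ R := by convert hR (n * x + b * y) (-y) using 1; push_cast; ring
  have hE₂R : E₂ ∈ R := by convert hR (b * x + c * y) x using 1; push_cast; ring
  set h : ℂ := u + v * sm2 with hh
  set h' : ℂ := u - v * sm2 with hh'
  have hhR : h ∈ R := add_mem (intCast_mem _ _) (mul_mem (intCast_mem _ _) (sm2_mem_Rf D f))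
  have hhR' : h' ∈ R := sub_mem (intCast_mem _ _) (mul_mem (intCast_mem _ _) (sm2_mem_Rf D f))
  have hhh : h * h' = N := by linear_combination (-(v : ℂ) ^ 2) * hs2
  have e11 : E₁ * F₁ = n * N := by
    linear_combination (-(y : ℂ) ^ 2) * hθ + (n : ℂ) * hNrep
  have e12 : E₁ * F₂ = (b - θ) * N := by
    linear_combination ((x : ℂ) * y) * hθ + (b - θ : ℂ) * hNrep
  have e21 : E₂ * F₁ = (b + θ) * N := by
    linear_combination ((x : ℂ) * y) * hθ + (b + θ : ℂ) * hNrep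
  have e22 : E₂ * F₂ = c * N := by
    linear_combination (-(x : ℂ) ^ 2) * hθ + (c : ℂ) * hNrep
  have hconj : conjSubmodule R (Submodule.span R {h, E₁, E₂}) = Submodule.span R {h', E₁, E₂} := by
    rw [conjSubmodule_span]
    have hθc : starRingEnd ℂ θ = θ := by rw [hθdef, map_mul, conj_s2D, map_natCast]
    have c1 : starRingEnd ℂ h = h' := by simp [hh, hh', conj_sm2, sub_eq_add_neg]
    have c2 : starRingEnd ℂ E₁ = E₁ := by simp [hE₁, hθc]
    have c3 : starRingEnd ℂ E₂ = E₂ := by simp [hE₂, hθc]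
    rw [Set.image_insert_eq, Set.image_pair, c1, c2, c3]
  have hnorm : Submodule.span R {h, E₁, E₂} * Submodule.span R {h', E₁, E₂}
      = Submodule.span R {E₁, E₂} := by
    refine le_antisymm ?_ ?_
    · rw [Submodule.span_mul_span, Submodule.span_le]
      have m1 : E₁ ∈ Submodule.span R {E₁, E₂} := Submodule.subset_span (by simp)
      have m2 : E₂ ∈ Submodule.span R {E₁, E₂} := Submodule.subset_span (by simp)
      have key : ∀ p ∈ R, p * E₁ ∈ Submodule.span R {E₁, E₂} ∧
          p * E₂ ∈ Submodule.span R {E₁, E₂} := fun p hp =>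
        ⟨mul_mem_of_mem_subring hp m1, mul_mem_of_mem_subring hp m2⟩
      rintro _ ⟨p, hp, q, hq, rfl⟩
      change p * q ∈ Submodule.span R {E₁, E₂}
      rcases hq with rfl | rfl | rfl
      · rcases hp with rfl | rfl | rfl
        · rw [hhh, show N = x * E₁ + y * E₂ by rw [← hNrep]; ring]
          exact add_mem (key _ (intCast_mem _ _)).1 (key _ (intCast_mem _ _)).2
        · rw [mul_comm]
          exact (key _ hhR').1
        · rw [mul_comm]
          exact (key _ hhR').2
      · refine (key _ ?_).1
        rcases hp with rfl | rfl | rfl <;> assumption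
      · refine (key _ ?_).2
        rcases hp with rfl | rfl | rfl <;> assumption
    · obtain ⟨α, β, hαβ⟩ := hxy
      obtain ⟨i, j, hij⟩ : IsCoprime (u ^ 2 + 2 * v ^ 2) (2 * (2 * (D : ℤ) * f ^ 2)) :=
        IsCoprime.mul_right hN.of_mul_right_left.of_mul_right_left hN
      rw [← hbc] at hij
      have hαβC : (α : ℂ) * x + β * y = 1 := by exact_mod_cast hαβ
      have hijC : (i : ℂ) * N + j * (2 * (b ^ 2 - n * c)) = 1 := by
        rw [hNdef]
        exact_mod_cast hij
      set M := Submodule.span R {h, E₁, E₂} * Submodule.span R {h', E₁, E₂}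
      have hmem {p q : ℂ} (hp : p ∈ ({h, E₁, E₂} : Set ℂ)) (hq : q ∈ ({h', E₁, E₂} : Set ℂ)) :
          p * q ∈ M :=
        Submodule.mul_mem_mul (Submodule.subset_span hp) (Submodule.subset_span hq)
      have hNM : N ∈ M := hhh ▸ hmem (by simp) (by simp)
      have hcomb : ∀ E : ℂ, E = ((-j * (α * c - β * b) : ℤ) : ℂ) * (E * E₁ + E * F₁)
          + ((-j * (β * n - α * b) : ℤ) : ℂ) * (E * E₂ + E * F₂) + (i : ℂ) * (E * N) := by
        intro E
        push_cast
        linear_combination (-E) * hijC - (2 * j * (b ^ 2 - n * c) * E : ℂ) * hαβC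
      rw [Submodule.span_le]
      have hi {z : ℂ} (k : ℤ) (hz : z ∈ M) : (k : ℂ) * z ∈ M :=
        mul_mem_of_mem_subring (intCast_mem _ k) hz
      rintro _ (rfl | rfl)
      · rw [SetLike.mem_coe, hcomb E₁]
        refine add_mem (add_mem (hi _ (add_mem (hmem (by simp) (by simp)) ?_))
          (hi _ (add_mem (hmem (by simp) (by simp)) ?_)))
          (hi _ (mul_mem_of_mem_subring hE₁R hNM))
        · rw [e11]
          exact hi _ hNM
        · rw [e12]
          exact mul_mem_of_mem_subring (sub_mem (intCast_mem _ _) hθR) hNM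
      · rw [SetLike.mem_coe, hcomb E₂]
        refine add_mem (add_mem (hi _ (add_mem (hmem (by simp) (by simp)) ?_))
          (hi _ (add_mem (hmem (by simp) (by simp)) ?_)))
          (hi _ (mul_mem_of_mem_subring hE₂R hNM))
        · rw [e21]
          exact mul_mem_of_mem_subring (add_mem (intCast_mem _ _) hθR) hNM
        · rw [e22]
          exact hi _ hNM
  refine ⟨Submodule.span R {h, E₁, E₂}, ?_,
    ⟨Submodule.span R {h', E₁, E₂} * Submodule.span R {F₁ / N, F₂ / N}, ?_⟩, ?_⟩
  · intro z hz
    refine mem_Kf_of_mem_Rf (f := f) ?_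
    induction hz using Submodule.span_induction with
    | mem z hz => rcases hz with rfl | rfl | rfl <;> assumption
    | zero => exact zero_mem _
    | add _ _ _ _ h h' => exact add_mem h h'
    | smul r _ _ h => exact mul_mem r.2 h
  · rw [← mul_assoc, hnorm, Submodule.span_mul_span]
    have g11 : E₁ * (F₁ / N) = n := by rw [← mul_div_assoc, e11, mul_div_cancel_right₀ _ hNC]
    have g12 : E₁ * (F₂ / N) = b - θ := by rw [← mul_div_assoc, e12, mul_div_cancel_right₀ _ hNC]
    have g21 : E₂ * (F₁ / N) = b + θ := by rw [← mul_div_assoc, e21, mul_div_cancel_right₀ _ hNC]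
    have g22 : E₂ * (F₂ / N) = c := by rw [← mul_div_assoc, e22, mul_div_cancel_right₀ _ hNC]
    refine le_antisymm (Submodule.span_le.2 ?_) (Submodule.one_le.2 ?_)
    · have hone {z : ℂ} (hz : z ∈ R) : z ∈ (1 : Submodule R ℂ) := Submodule.mem_one.2 ⟨⟨z, hz⟩, rfl⟩
      rintro _ ⟨p, (rfl | rfl), q, (rfl | rfl), rfl⟩
      · exact hone (by simpa only [g11] using intCast_mem R n)
      · exact hone (by simpa only [g12] using sub_mem (intCast_mem R b) hθR)
      · exact hone (by simpa only [g21] using add_mem (intCast_mem R b) hθR)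
      · exact hone (by simpa only [g22] using intCast_mem R c)
    · obtain ⟨k, l, hkl⟩ : IsCoprime n (2 * b) := by
        refine IsCoprime.mul_right hc.of_mul_right_left.of_mul_right_left ?_
        rw [← hbc, show b ^ 2 - n * c = b ^ 2 + n * (-c) by ring] at hc
        exact (IsCoprime.pow_right_iff two_pos).1 (IsCoprime.of_add_mul_left_right hc)
      have hklC : (1 : ℂ) = k * n + l * (2 * b) := by exact_mod_cast hkl.symm
      rw [hklC, show (2 * b : ℂ) = (b - θ) + (b + θ) by ring, ← g11, ← g12, ← g21]
      have hm {p q : ℂ} (hp : p ∈ ({E₁, E₂} : Set ℂ)) (hq : q ∈ ({F₁ / N, F₂ / N} : Set ℂ)) :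
          p * q ∈ Submodule.span R (({E₁, E₂} : Set ℂ) * {F₁ / N, F₂ / N}) :=
        Submodule.subset_span (Set.mul_mem_mul hp hq)
      exact add_mem (mul_mem_of_mem_subring (intCast_mem R k) (hm (by simp) (by simp)))
        (mul_mem_of_mem_subring (intCast_mem R l)
          (add_mem (hm (by simp) (by simp)) (hm (by simp) (by simp))))
  · rw [hconj, hnorm]

/-- The norm map `N : Cl(R_f) → Cl⁺(R⁺_f)` is surjective: for every invertible
fractional `R⁺_f`-ideal `𝔅` there is an invertible fractional `R_f`-ideal `𝔄`
and a nonzero totally positive element `t` of `K⁺` such that `𝔄·𝔄̄` is the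
extension to `R_f` of the fractional `R⁺_f`-ideal `t·𝔅`; i.e. the narrow class
of `N(𝔄)` is the class of `𝔅`. -/
theorem norm_map_on_class_groups_surjective (D : ℕ) (hD0 : 0 < D)
    (hDsf : Squarefree D) (hD4 : D % 4 = 1) (f : ℕ) (hf1 : Odd f) (hf0 : 0 < f)
    (B : Submodule (Rpf D f) ℂ) (hBK : (B : Set ℂ) ⊆ Kp D)
    (hBinv : ∃ B' : Submodule (Rpf D f) ℂ, B * B' = 1) :
    ∃ A : Submodule (Rf D f) ℂ, (A : Set ℂ) ⊆ Kf D ∧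
      (∃ A' : Submodule (Rf D f) ℂ, A * A' = 1) ∧
      ∃ t : Kp D, t ≠ 0 ∧ (∀ φ : Kp D →+* ℝ, 0 < φ t) ∧
        A * conjSubmodule (Rf D f) A =
          Submodule.span (Rf D f) ((t : ℂ) • (B : Set ℂ)) := by
  obtain ⟨t₁, n, b, c, hn0, ht₁, hbc, hcop, hB, ⟨β₁, hβ₁, h₁⟩, β₂, hβ₂, h₂⟩ :=
    exists_normal_form hD0 hD4 hf0 hBK hBinv
  obtain ⟨x, y, u, v, hxy, hrep, hN⟩ := exists_primitive_rep hD0 hDsf hD4 hf1 hn0 hbc hcop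
  have hN0 : u ^ 2 + 2 * v ^ 2 ≠ 0 :=
    ne_zero_of_isCoprime_two_mul (b := D * f ^ 2) (by rwa [← mul_assoc])
  obtain ⟨A, hAK, hAinv, hA⟩ := exists_ideal_of_rep hbc hcop hxy hrep hN hN0
  set θ : ℂ := f * s2D D with hθdef
  have hbcC : (b : ℂ) ^ 2 - n * c = 2 * D * f ^ 2 := by exact_mod_cast hbc
  have hθ : θ ^ 2 = b ^ 2 - n * c := by
    rw [hbcC, hθdef]
    linear_combination (f ^ 2 : ℂ) * s2D_sq D
  rw [Int.cast_natCast] at hA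
  set E₁ : ℂ := n * x + b * y - y * θ with hE₁
  set E₂ : ℂ := b * x + c * y + x * θ with hE₂
  have hnC : (n : ℂ) ≠ 0 := by exact_mod_cast hn0.ne'
  have hE₁pos : PosNorm D E₁ := by
    refine ⟨n * x + b * y, -y * f, by rw [hE₁, hθdef]; push_cast; ring, ?_⟩
    have hbcQ : (b : ℚ) ^ 2 - n * c = 2 * D * f ^ 2 := by exact_mod_cast hbc
    have hrepQ : (n : ℚ) * x ^ 2 + 2 * b * x * y + c * y ^ 2 = u ^ 2 + 2 * v ^ 2 := by
      exact_mod_cast hrep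
    rw [show ((n : ℚ) * x + b * y) ^ 2 - 2 * D * (-y * f) ^ 2 = n * (u ^ 2 + 2 * v ^ 2) by
      linear_combination (y : ℚ) ^ 2 * hbcQ + (n : ℚ) * hrepQ]
    have : 0 < u ^ 2 + 2 * v ^ 2 := lt_of_le_of_ne (by positivity) hN0.symm
    have : (0 : ℚ) < u ^ 2 + 2 * v ^ 2 := by exact_mod_cast this
    positivity
  have hpos : PosNorm D (t₁ * E₁ / n) := by
    simpa using (ht₁.mul hE₁pos).div_intCast (c := n) (by exact_mod_cast hn0.ne')
  have hmul : E₁ * (b + θ) = n * E₂ := by linear_combination (-(y : ℂ)) * hθ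
  have hspan : Submodule.span (Rf D f) ((t₁ * E₁ / n) • (B : Set ℂ))
      = Submodule.span (Rf D f) {E₁, E₂} := by
    refine le_antisymm (Submodule.span_le.2 ?_) (Submodule.span_mono ?_)
    · rintro _ ⟨β, hβ, rfl⟩
      obtain ⟨i, k, hik⟩ := hB β hβ
      have : t₁ * E₁ / n * β = i * E₁ + k * E₂ := by
        field_simp
        linear_combination E₁ * hik + (k : ℂ) * hmul
      change t₁ * E₁ / n * β ∈ _
      rw [this]
      exact add_mem
        (mul_mem_of_mem_subring (intCast_mem _ i) (Submodule.subset_span (by simp)))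
        (mul_mem_of_mem_subring (intCast_mem _ k) (Submodule.subset_span (by simp)))
    · rintro _ (rfl | rfl)
      · refine ⟨β₁, hβ₁, ?_⟩
        change t₁ * E₁ / n * β₁ = E₁
        field_simp
        linear_combination E₁ * h₁
      · refine ⟨β₂, hβ₂, ?_⟩
        change t₁ * E₁ / n * β₂ = E₂
        field_simp
        linear_combination E₁ * h₂ + hmul
  obtain ⟨t, ht, ht0, htpos⟩ := hpos.exists_totally_positive
  refine ⟨A, hAK, hAinv, t, ht0, htpos, ?_⟩
  have hneg : -(B : Set ℂ) = B := by
    ext z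
    simp
  rw [hA, ← hspan]
  rcases ht with ht | ht
  · rw [ht]
  · rw [ht, Set.neg_smul_set, ← Set.smul_set_neg, hneg]
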